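/- arXiv:2401.17413 — 9 statements merged into one kernel-verified Lean document; each statement's English description precedes it below -/
import Mathlib

section
/- Let S ⊆ E be an upper set (with respect to the componentwise order). If B = {x ∈ E | ∀ j, x j ∈ M j} is a box that is maximal in S, then there exists a ∈ E such that M j = Set.Ici (a j) for every j, i.e. B = {x ∈ E | a ≤ x}. -/
/-- `B ⊆ Fin n → Fin k` is a box (interval/sublattice of the `n`-dimensional `k`-lattice):
`B = {x | ∀ j, x j ∈ M j}` with every `M j` nonempty. -/
def IsBox {n k : ℕ} (B : Set (Fin n → Fin k)) : Prop :=
  ∃ M : Fin n → Set (Fin k), (∀ j, (M j).Nonempty) ∧ B = {x | ∀ j, x j ∈ M j}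

/-- `B` is a box maximal in `S`: `B ⊆ S` and no box strictly between `B` and `S`. -/
def MaximalBoxIn {n k : ℕ} (S B : Set (Fin n → Fin k)) : Prop :=
  IsBox B ∧ B ⊆ S ∧ ∀ B' : Set (Fin n → Fin k), IsBox B' → B ⊂ B' → ¬B' ⊆ S

/-- Theorem 1(a): every box maximal in an upper set `S ⊆ Fin n → Fin k`
(componentwise order) has all its component sets of the form `[a j, k-1]`,
i.e. it equals `{x | a ≤ x}` for some `a`. -/
theorem maximalBox_in_upperSet_eq_Ici {n k : ℕ} (hk : 1 ≤ k)
    (S : Set (Fin n → Fin k)) (hS : IsUpperSet S)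
    (M : Fin n → Set (Fin k)) (hM : ∀ j, (M j).Nonempty)
    (hmax : MaximalBoxIn S {x | ∀ j, x j ∈ M j}) :
    ∃ a : Fin n → Fin k, ∀ j, M j = Set.Ici (a j) := by
  choose a ha using fun j => (Set.toFinite (M j)).exists_minimal (hM j)
  have hle : ∀ j, ∀ y ∈ M j, a j ≤ y := fun j y hy =>
    (le_total (a j) y).elim id ((ha j).le_of_le hy)
  obtain ⟨-, hsub, hmax⟩ := hmax
  have haS : a ∈ S := hsub fun j => (ha j).prop
  refine ⟨a, fun j => Set.Subset.antisymm (hle j) fun y hy => ?_⟩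
  by_contra hyM
  refine hmax {x | ∀ j, x j ∈ Set.Ici (a j)}
    ⟨fun j => Set.Ici (a j), fun _ => Set.nonempty_Ici, rfl⟩ ?_ fun x hx => hS hx haS
  refine ⟨fun x hx i => hle i _ (hx i), fun hsup => hyM ?_⟩
  have hmem : Function.update a j y ∈ {x | ∀ i, x i ∈ Set.Ici (a i)} :=
    fun i => (le_update_self_iff.mpr hy : a ≤ Function.update a j y) i
  simpa using hsup hmem j
end

section
/- Let S ⊆ E be an upper set and let B = {x ∈ E | a ≤ x} be a box maximal in S (a ∈ E). Then a ∈ B, and every box B' that is maximal in S and contains the point a satisfies B' = B. (The corner a is a core point: it belongs to no maximal box of S other than B.) -/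
/-- A box inside an upper set `S` can be enlarged, within `S`, to a box containing the
principal upper set of any of its points. -/
theorem IsBox.exists_isBox_union_Ici_subset {n k : ℕ} {S B : Set (Fin n → Fin k)}
    (hS : IsUpperSet S) (hB : IsBox B) (hBS : B ⊆ S) {a : Fin n → Fin k} (ha : a ∈ B) :
    ∃ C, IsBox C ∧ B ⊆ C ∧ {x | a ≤ x} ⊆ C ∧ C ⊆ S := by
  classical
  obtain ⟨M, hM, rfl⟩ := hB
  refine ⟨{x | ∀ j, x j ∈ M j ∪ Set.Ici (a j)}, ⟨_, fun j => (hM j).inl, rfl⟩,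
    fun x hx j => Or.inl (hx j), fun x hx j => Or.inr (hx j), fun x hx => ?_⟩
  have hy : (fun j => if x j ∈ M j then x j else a j) ∈ S := by
    refine hBS fun j => ?_
    split_ifs with h
    exacts [h, ha j]
  refine hS (fun j => ?_) hy
  dsimp only
  split_ifs with h
  exacts [le_rfl, (hx j).resolve_left h]

/-- A maximal box in `S` equals every box in `S` containing it. -/
theorem MaximalBoxIn.eq_of_subset {n k : ℕ} {S B C : Set (Fin n → Fin k)}
    (hB : MaximalBoxIn S B) (hC : IsBox C) (hBC : B ⊆ C) (hCS : C ⊆ S) : B = C := by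
  by_contra hne
  exact hB.2.2 C hC (hBC.ssubset_of_ne hne) hCS

/-- Core-point step of Theorem 1(b): if `B = {x | a ≤ x}` is a box maximal in an
upper set `S`, then its corner `a` belongs to `B` and to no other box maximal in `S`. -/
theorem corner_is_core_point {n k : ℕ} (hk : 1 ≤ k)
    (S : Set (Fin n → Fin k)) (hS : IsUpperSet S) (a : Fin n → Fin k)
    (hmax : MaximalBoxIn S {x | a ≤ x}) :
    a ∈ {x : Fin n → Fin k | a ≤ x} ∧
      ∀ B' : Set (Fin n → Fin k), MaximalBoxIn S B' → a ∈ B' →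
        B' = {x : Fin n → Fin k | a ≤ x} := by
  refine ⟨le_refl a, fun B' hB' ha => ?_⟩
  obtain ⟨C, hC, hBC, haC, hCS⟩ :=
    hB'.1.exists_isBox_union_Ici_subset hS hB'.2.1 ha
  exact (hB'.eq_of_subset hC hBC hCS).trans (hmax.eq_of_subset hC haC hCS).symm
end

section
/- Let f : E → Fin k be monotone with respect to the componentwise order and let γ ∈ Fin k. Then S_γ = {x ∈ E | γ ≤ f x} is an upper set, and every box maximal in S_γ has the form {x ∈ E | a ≤ x} for some a ∈ E (each component set is an upper interval [a_j, k−1]). -/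
/-- Corollary to Theorem 1: for a monotone `k`-valued function `f`, each set
`S_γ = {x | γ ≤ f x}` is an upper set and every box maximal in `S_γ` has the form
`{x | a ≤ x}` (all component sets are upper intervals `[a j, k-1]`). -/
theorem monotone_level_upperSet_and_maximal_boxes {n k : ℕ} (hk : 1 ≤ k)
    (f : (Fin n → Fin k) → Fin k) (hf : Monotone f) (γ : Fin k) :
    IsUpperSet {x : Fin n → Fin k | γ ≤ f x} ∧
      ∀ B : Set (Fin n → Fin k), MaximalBoxIn {x | γ ≤ f x} B →
        ∃ a : Fin n → Fin k, B = {x | a ≤ x} := by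
  refine ⟨fun x y hxy hx => le_trans hx (hf hxy), ?_⟩
  rintro B ⟨⟨M, hM, rfl⟩, hBS, hmax⟩
  choose a ha hmin using fun j => (M j).toFinite.exists_minimal (hM j)
  have hle : {x | ∀ j, x j ∈ M j} ⊆ {x | a ≤ x} := fun x hx j =>
    (le_total (a j) (x j)).elim id (hmin j (hx j))
  refine ⟨a, by_contra fun hne => hmax {x | a ≤ x} ?_ (hle.ssubset_of_ne hne) ?_⟩
  · exact ⟨fun j => Set.Ici (a j), fun j => Set.nonempty_Ici, rfl⟩
  · exact fun x hx => le_trans (hBS ha) (hf hx)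
end

section
/- Let f : E → Fin k be monotone with respect to the componentwise order and let γ ∈ Fin k. If B = {x ∈ E | ∀ j, x j ∈ M j} is a box maximal in the level set f⁻¹({γ}) = {x ∈ E | f x = γ}, then for every j there exist a j ≤ b j in Fin k with M j = Set.Icc (a j) (b j); in particular no component M j is a disconnected subset of Fin k. -/
/-- Corollary to Theorem 1: for a monotone `k`-valued function `f`, every box maximal
in a level set `{x | f x = γ}` has all component sets equal to intervals
`Set.Icc (a j) (b j)`; no component is a disconnected subset of `Fin k`. -/
theorem maximalBox_in_level_set_components_are_intervals {n k : ℕ} (hk : 1 ≤ k)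
    (f : (Fin n → Fin k) → Fin k) (hf : Monotone f) (γ : Fin k)
    (M : Fin n → Set (Fin k)) (hM : ∀ j, (M j).Nonempty)
    (hmax : MaximalBoxIn {x | f x = γ} {x | ∀ j, x j ∈ M j}) :
    ∀ j, ∃ a b : Fin k, a ≤ b ∧ M j = Set.Icc a b := by
  choose a haM ha using fun j => Set.exists_min_image (M j) id (M j).toFinite (hM j)
  choose b hbM hb using fun j => Set.exists_max_image (M j) id (M j).toFinite (hM j)
  have hab : ∀ j, a j ≤ b j := fun j => ha j _ (hbM j)
  obtain ⟨-, hS, hmax⟩ := hmax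
  have hsub : {x | ∀ j, x j ∈ M j} ⊆
      {x : Fin n → Fin k | ∀ j, x j ∈ Set.Icc (a j) (b j)} :=
    fun x hx j => ⟨ha j _ (hx j), hb j _ (hx j)⟩
  have hIcc : {x : Fin n → Fin k | ∀ j, x j ∈ Set.Icc (a j) (b j)} ⊆ {x | f x = γ} := by
    intro x hx
    have hfa : f a = γ := hS haM
    have hfb : f b = γ := hS hbM
    exact le_antisymm (hfb ▸ hf fun j => (hx j).2) (hfa ▸ hf fun j => (hx j).1)
  have hsup : {x : Fin n → Fin k | ∀ j, x j ∈ Set.Icc (a j) (b j)} ⊆ {x | ∀ j, x j ∈ M j} := by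
    by_contra hne
    exact hmax _ ⟨_, fun j => Set.nonempty_Icc.2 (hab j), rfl⟩ ⟨hsub, hne⟩ hIcc
  refine fun j => ⟨a j, b j, hab j, Set.Subset.antisymm
    (fun t ht => ⟨ha j t ht, hb j t ht⟩) ?_⟩
  intro t ht
  have hmem : Function.update a j t ∈ {x : Fin n → Fin k | ∀ j, x j ∈ Set.Icc (a j) (b j)} := by
    intro i
    rcases eq_or_ne i j with rfl | hij
    · simpa using ht
    · simpa [hij] using hab i
  simpa using hsup hmem j
end

section
/- Let ⪯ be the partial order on Fin k (k ≥ 2) in which 0 ⪯ a for every a and any two distinct nonzero elements are incomparable, extended componentwise to E. If S ⊆ E is a ⪯-upper set and B = {x ∈ E | ∀ j, x j ∈ M j} is a box maximal in S, then for every j either M j = Set.univ or 0 ∉ M j. (Elementary conjunctions for functions of the class S consist only of elementary formulas J_T(x) with T ⊆ E_k \ {0}.) -/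
/-- The flat partial order on `Fin k`: `0 ⪯ a` for every `a`, distinct nonzero
elements incomparable; so `a ⪯ b` iff `a = b` or `a = 0`. -/
def FlatLE {k : ℕ} [NeZero k] (a b : Fin k) : Prop := a = b ∨ a = 0

/-- For the flat partial order `0 ⪯ a` on `Fin k` (distinct nonzero elements
incomparable), extended componentwise: if `S` is a `⪯`-upper set and
`{x | ∀ j, x j ∈ M j}` is a box maximal in `S`, then every component `M j` is either
all of `Fin k` or avoids `0` (elementary conjunctions of functions of the class `S`
only use formulas `J_T(x)` with `T ⊆ E_k \ {0}`). -/
theorem maximalBox_in_flat_upperSet {n k : ℕ} [NeZero k] (hk : 2 ≤ k)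
    (S : Set (Fin n → Fin k))
    (hS : ∀ x ∈ S, ∀ y : Fin n → Fin k, (∀ j, FlatLE (x j) (y j)) → y ∈ S)
    (M : Fin n → Set (Fin k)) (hM : ∀ j, (M j).Nonempty)
    (hmax : MaximalBoxIn S {x | ∀ j, x j ∈ M j}) :
    ∀ j, M j = Set.univ ∨ (0 : Fin k) ∉ M j := by
  obtain ⟨-, hsub, hmax⟩ := hmax
  intro j
  by_contra! h
  obtain ⟨hne, h0⟩ := h
  obtain ⟨a, ha⟩ := (Set.ne_univ_iff_exists_notMem _).1 hne
  refine hmax {x | ∀ i, x i ∈ Function.update M j Set.univ i} ⟨_, fun i => ?_, rfl⟩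
    ⟨fun x hx i => ?_, fun hle => ?_⟩ fun y hy => ?_
  · rcases eq_or_ne i j with rfl | hi
    · simp
    · simpa [hi] using hM i
  · rcases eq_or_ne i j with rfl | hi
    · simp
    · simpa [hi] using hx i
  · choose f hf using hM
    refine ha ?_
    have hmem := hle (a := Function.update f j a) (fun i => ?_) j
    · simpa using hmem
    · rcases eq_or_ne i j with rfl | hi
      · simp
      · simpa [hi] using hf i
  · refine hS (Function.update y j 0) (hsub fun i => ?_) y fun i => ?_
    · rcases eq_or_ne i j with rfl | hi
      · simpa using h0
      · simpa [hi] using hy i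
    · rcases eq_or_ne i j with rfl | hi
      · simp [FlatLE]
      · simp [FlatLE, hi]
end

section
/- Let k ≥ 2 and let Z : Fin k → ℝ satisfy ∑_{i} Z i = 0 and Z i − Z 0 ≥ 1 for every i ≠ 0. Then (1/k) · ∑_{i} (Z i)² ≥ (k−1)/k². -/
/-- In an admissible, mean-zero image of the basic graph of the order
`0 < 1, …, 0 < k-1` on `E_k` (so `Z i - Z 0 ≥ 1` for `i ≠ 0` and `∑ Z i = 0`),
the variance `(1/k) ∑ (Z i)²` is at least `(k-1)/k²`. -/
theorem admissible_image_variance_bound {k : ℕ} [NeZero k] (hk : 2 ≤ k)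
    (Z : Fin k → ℝ) (hsum : ∑ i, Z i = 0)
    (harc : ∀ i : Fin k, i ≠ 0 → 1 ≤ Z i - Z 0) :
    ((k : ℝ) - 1) / (k : ℝ) ^ 2 ≤ (1 / (k : ℝ)) * ∑ i, (Z i) ^ 2 := by
  have hk0 : (0 : ℝ) < k := by positivity
  have hZ0 : (k : ℝ) - 1 ≤ -(k * Z 0) := by
    have h : ∑ i : Fin k, ((1 : ℝ) - if i = 0 then 1 else 0) ≤ ∑ i, (Z i - Z 0) := by
      refine Finset.sum_le_sum fun i _ => ?_
      by_cases hi : i = 0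
      · simp [hi]
      · simpa [hi] using harc i hi
    simpa [Finset.sum_sub_distrib, hsum] using h
  have hsq : -(2 * Z 0) - ((k : ℝ) - 1) / k ≤ ∑ i, (Z i) ^ 2 := by
    have h : ∑ i : Fin k, (2 / (k : ℝ) * Z i - 1 / (k : ℝ) ^ 2
        + if i = 0 then 2 / (k : ℝ) - 1 - 2 * Z 0 else 0) ≤ ∑ i, (Z i) ^ 2 := by
      refine Finset.sum_le_sum fun i _ => ?_
      by_cases hi : i = 0
      · subst hi
        have := sq_nonneg (Z 0 - (1 / (k : ℝ) - 1))
        simp only [if_true]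
        ring_nf at this ⊢
        linarith
      · have := sq_nonneg (Z i - 1 / (k : ℝ))
        simp only [hi, if_false]
        ring_nf at this ⊢
        linarith
    rw [Finset.sum_add_distrib, Finset.sum_sub_distrib, ← Finset.mul_sum, hsum] at h
    simp only [Finset.sum_const, Finset.card_univ, Fintype.card_fin, nsmul_eq_mul,
      Finset.sum_ite_eq', Finset.mem_univ, if_true] at h
    convert h using 1
    field_simp
    ring
  have hdiv : ((k : ℝ) - 1) / k ≤ -Z 0 := by
    rw [div_le_iff₀ hk0]
    linarith
  calc ((k : ℝ) - 1) / (k : ℝ) ^ 2 = 1 / (k : ℝ) * (((k : ℝ) - 1) / k) := by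
        field_simp
    _ ≤ 1 / (k : ℝ) * ∑ i, (Z i) ^ 2 := by
        gcongr
        linarith
end

section
/- Let t ≤ n and for each i ∈ Fin n with (i : ℕ) < t let T i ⊆ Fin k be nonempty with 0 ∉ T i; put B = {x ∈ E | ∀ i, (i : ℕ) < t → x i ∈ T i}. Let J be a finite index set and for each j ∈ J let S j : Fin n → Set (Fin k) be such that for every i either S j i = Set.univ or (S j i is nonempty and 0 ∉ S j i); put B_j = {x ∈ E | ∀ i, x i ∈ S j i} and B'_j = {x ∈ E | ∀ i, S j i ≠ Set.univ → x i ≠ 0}. If B ⊆ ⋃_{j ∈ J} B_j, then E^{n,t} := {x ∈ E | ∀ i, (i : ℕ) < t → x i ≠ 0} ⊆ ⋃_{j ∈ J} B'_j. -/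
/-- Necessity direction of Theorem 2. For an elementary conjunction of the class `S`
with truth region `B = {x | ∀ i < t, x i ∈ T i}` (each `T i` nonempty, avoiding `0`)
and elementary conjunctions with truth regions `B j = {x | ∀ i, x i ∈ S j i}` (each
component either `univ` or nonempty avoiding `0`), if `⋁ K_j` absorbs `K`
(`B ⊆ ⋃ j, B_j`), then the widened conjunctions `K'_j` (every non-trivial elementary
formula replaced by `J_{[1,k-1]}`) cover all of `E^{n,t}`. -/
theorem absorption_necessity {n k t : ℕ} [NeZero k] (hk : 2 ≤ k) (ht : t ≤ n)
    (T : Fin n → Set (Fin k))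
    (hT : ∀ i : Fin n, (i : ℕ) < t → (T i).Nonempty ∧ (0 : Fin k) ∉ T i)
    {ι : Type*} (J : Finset ι) (S : ι → Fin n → Set (Fin k))
    (hS : ∀ j ∈ J, ∀ i : Fin n,
      S j i = Set.univ ∨ ((S j i).Nonempty ∧ (0 : Fin k) ∉ S j i))
    (habs : {x : Fin n → Fin k | ∀ i : Fin n, (i : ℕ) < t → x i ∈ T i} ⊆
      ⋃ j ∈ J, {x : Fin n → Fin k | ∀ i : Fin n, x i ∈ S j i}) :
    {x : Fin n → Fin k | ∀ i : Fin n, (i : ℕ) < t → x i ≠ 0} ⊆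
      ⋃ j ∈ J, {x : Fin n → Fin k | ∀ i : Fin n, S j i ≠ Set.univ → x i ≠ 0} := by
  classical
  intro y hy
  choose a ha using fun (i : Fin n) (h : (i : ℕ) < t) ↦ (hT i h).1
  have hx := habs (a := fun i ↦ if h : (i : ℕ) < t then a i h else y i) fun i hi ↦ by
    simpa only [hi, dite_true] using ha i hi
  simp only [Set.mem_iUnion, Set.mem_ofPred_eq, exists_prop] at hx ⊢
  obtain ⟨j, hj, hxj⟩ := hx
  refine ⟨j, hj, fun i hi hyi ↦ ?_⟩
  by_cases h : (i : ℕ) < t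
  · exact hy i h hyi
  · have hxi := hxj i
    rw [dif_neg h, hyi] at hxi
    exact ((hS j hj i).resolve_left hi).2 hxi
end

section
/- Let t ≤ n and for each i ∈ Fin n with (i : ℕ) < t let T i ⊆ Fin k be nonempty with 0 ∉ T i; put B = {x ∈ E | ∀ i, (i : ℕ) < t → x i ∈ T i}. Let J be a finite index set and for each j ∈ J let S j : Fin n → Set (Fin k) be such that for every i either S j i = Set.univ or (S j i is nonempty and 0 ∉ S j i); put B_j = {x ∈ E | ∀ i, x i ∈ S j i} and B'_j = {x ∈ E | ∀ i, S j i ≠ Set.univ → x i ≠ 0}. Assume additionally that B ∩ B'_j ⊆ B_j for every j ∈ J. Then B ⊆ ⋃_{j ∈ J} B_j if and only if E^{n,t} := {x ∈ E | ∀ i, (i : ℕ) < t → x i ≠ 0} ⊆ ⋃_{j ∈ J} B'_j. -/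
/-- Theorem 2. For an elementary conjunction of the class `S` with truth region
`B = {x | ∀ i < t, x i ∈ T i}` (each `T i` nonempty, avoiding `0`) and elementary
conjunctions with truth regions `B_j = {x | ∀ i, x i ∈ S j i}` (each component either
`univ` or nonempty avoiding `0`), let `B'_j` be the truth region of the widened
conjunction `K'_j` (every non-trivial elementary formula replaced by `J_{[1,k-1]}`).
Assume `B ∩ B'_j ⊆ B_j` for all `j` (the property `U_K ∩ (U_{K'_j} \ U_{K_j}) = ∅`).
Then the disjunction `⋁ K_j` absorbs `K` (`B ⊆ ⋃ j, B_j`) iff the widened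
conjunctions cover all of `E^{n,t}`. -/
theorem absorption_criterion {n k t : ℕ} [NeZero k] (hk : 2 ≤ k) (ht : t ≤ n)
    (T : Fin n → Set (Fin k))
    (hT : ∀ i : Fin n, (i : ℕ) < t → (T i).Nonempty ∧ (0 : Fin k) ∉ T i)
    {ι : Type*} (J : Finset ι) (S : ι → Fin n → Set (Fin k))
    (hS : ∀ j ∈ J, ∀ i : Fin n,
      S j i = Set.univ ∨ ((S j i).Nonempty ∧ (0 : Fin k) ∉ S j i))
    (hadq : ∀ j ∈ J,
      {x : Fin n → Fin k | ∀ i : Fin n, (i : ℕ) < t → x i ∈ T i} ∩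
          {x : Fin n → Fin k | ∀ i : Fin n, S j i ≠ Set.univ → x i ≠ 0} ⊆
        {x : Fin n → Fin k | ∀ i : Fin n, x i ∈ S j i}) :
    {x : Fin n → Fin k | ∀ i : Fin n, (i : ℕ) < t → x i ∈ T i} ⊆
        ⋃ j ∈ J, {x : Fin n → Fin k | ∀ i : Fin n, x i ∈ S j i} ↔
      {x : Fin n → Fin k | ∀ i : Fin n, (i : ℕ) < t → x i ≠ 0} ⊆
        ⋃ j ∈ J, {x : Fin n → Fin k | ∀ i : Fin n, S j i ≠ Set.univ → x i ≠ 0} := by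
  constructor
  · intro hB x hx
    choose c hc using fun (i : Fin n) (hi : (i : ℕ) < t) => (hT i hi).1
    have hy : (fun i : Fin n => if hi : (i : ℕ) < t then c i hi else x i) ∈
        {x : Fin n → Fin k | ∀ i : Fin n, (i : ℕ) < t → x i ∈ T i} := by
      intro i hi
      simpa only [dif_pos hi] using hc i hi
    obtain ⟨j, hj, hyj⟩ := Set.mem_iUnion₂.1 (hB hy)
    refine Set.mem_iUnion₂.2 ⟨j, hj, fun i hi => ?_⟩
    by_cases hit : (i : ℕ) < t
    · exact hx i hit
    · have hxi : x i ∈ S j i := by simpa only [dif_neg hit] using hyj i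
      exact ne_of_mem_of_not_mem hxi ((hS j hj i).resolve_left hi).2
  · intro hE x hx
    obtain ⟨j, hj, hxj⟩ := Set.mem_iUnion₂.1
      (hE fun i hi => ne_of_mem_of_not_mem (hx i hi) (hT i hi).2)
    exact Set.mem_iUnion₂.2 ⟨j, hj, hadq j hj ⟨hx, hxj⟩⟩
end

section
/- Let ⪯ be the partial order on Fin k (k ≥ 2) in which 0 ⪯ a for every a and any two distinct nonzero elements are incomparable. For nonempty H, H' ⊆ Fin k write H ≤ H' iff a ⪯ b for all a ∈ H and b ∈ H'. Let s ≥ 1 and let H_0, H_1, …, H_{s+1} be nonempty, pairwise distinct subsets of Fin k with H_i ≤ H_{i+1} for all i and |H_0| = |H_{s+1}| = 1. Then s = 1 and there exists a nonzero m ∈ Fin k with H_0 = {0}, H_1 = {0, m}, H_2 = {m}; in particular |H_i| ≤ 2 for every i (so the constant d of the paper equals 2), and there are exactly k−1 such chains. -/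
/-- `H ≤ H'` for subsets of `Fin k`: every element of `H` precedes (in the flat
order) every element of `H'`. -/
def SetFlatLE {k : ℕ} [NeZero k] (H H' : Set (Fin k)) : Prop :=
  ∀ a ∈ H, ∀ b ∈ H', FlatLE a b

theorem SetFlatLE.eq_singleton {k : ℕ} [NeZero k] {A B : Set (Fin k)} (h : SetFlatLE A B)
    (hB : B.Nonempty) {m : Fin k} (hm : m ∈ A) (hm0 : m ≠ 0) : B = {m} :=
  hB.subset_singleton_iff.1 fun b hb => ((h m hm b hb).resolve_right hm0).symm

/-- A three-term chain of distinct nonempty sets starting at a singleton is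
`{0} ≤ {0, m} ≤ {m}`. -/
theorem SetFlatLE.eq_of_triple {k : ℕ} [NeZero k] {A B C : Set (Fin k)}
    (hAB : SetFlatLE A B) (hBC : SetFlatLE B C) (hB : B.Nonempty) (hC : C.Nonempty)
    (hABne : A ≠ B) (hBCne : B ≠ C) (hA : A.ncard = 1) :
    ∃ m : Fin k, m ≠ 0 ∧ A = {0} ∧ B = {0, m} ∧ C = {m} := by
  obtain ⟨a, rfl⟩ := Set.ncard_eq_one.1 hA
  have ha : a = 0 := by
    by_contra ha
    exact hABne (hAB.eq_singleton hB rfl ha).symm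
  subst ha
  obtain ⟨m, hmB, hm0⟩ : ∃ m ∈ B, m ≠ 0 := by
    by_contra! h
    exact hABne (hB.subset_singleton_iff.1 h).symm
  have hCm : C = {m} := hBC.eq_singleton hC hmB hm0
  subst hCm
  have hsub : ∀ b ∈ B, b = m ∨ b = 0 := fun b hb => hBC b hb m rfl
  have h0B : (0 : Fin k) ∈ B := by
    by_contra h0
    refine hBCne (hB.subset_singleton_iff.1 fun b hb => (hsub b hb).resolve_right ?_)
    rintro rfl
    exact h0 hb
  refine ⟨m, hm0, rfl, Set.Subset.antisymm (fun b hb => (hsub b hb).symm) ?_, rfl⟩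
  rintro b (rfl | rfl)
  · exact h0B
  · exact hmB

theorem setFlatLE_triples_eq_image {k : ℕ} [NeZero k] :
    {H' : Fin 3 → Set (Fin k) |
        (∀ i, (H' i).Nonempty) ∧ (∀ i j, i ≠ j → H' i ≠ H' j) ∧
        SetFlatLE (H' 0) (H' 1) ∧ SetFlatLE (H' 1) (H' 2) ∧
        (H' 0).ncard = 1 ∧ (H' 2).ncard = 1} =
      (fun m : Fin k => ![{0}, {0, m}, {m}]) '' {0}ᶜ := by
  ext H'
  constructor
  · rintro ⟨hne, hd, h01, h12, hc, -⟩
    obtain ⟨m, hm, e0, e1, e2⟩ := h01.eq_of_triple h12 (hne 1) (hne 2)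
      (hd 0 1 (by decide)) (hd 1 2 (by decide)) hc
    refine ⟨m, hm, ?_⟩
    ext1 i
    fin_cases i
    · exact e0.symm
    · exact e1.symm
    · exact e2.symm
  · rintro ⟨m, hm, rfl⟩
    have hm0 : m ≠ 0 := hm
    have h01 : ({0} : Set (Fin k)) ≠ {0, m} := fun h =>
      hm0 (h.symm.subset (Set.mem_insert_of_mem 0 rfl))
    have h12 : ({0, m} : Set (Fin k)) ≠ {m} := fun h =>
      hm0 (h.subset (Set.mem_insert 0 {m})).symm
    have h02 : ({0} : Set (Fin k)) ≠ {m} := fun h =>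
      hm0 (Set.singleton_injective h).symm
    refine ⟨?_, ?_, ?_, ?_, Set.ncard_singleton _, Set.ncard_singleton _⟩
    · intro i
      fin_cases i <;> simp
    · intro i j hij
      fin_cases i <;> fin_cases j
      · exact absurd rfl hij
      · exact h01
      · exact h02
      · exact h01.symm
      · exact absurd rfl hij
      · exact h12
      · exact h02.symm
      · exact h12.symm
      · exact absurd rfl hij
    · rintro a ha b -
      exact Or.inr ha
    · rintro a (rfl | rfl) b hb
      · exact Or.inr rfl
      · exact Or.inl (Eq.symm hb)

theorem ncard_setFlatLE_triples {k : ℕ} [NeZero k] :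
    {H' : Fin 3 → Set (Fin k) |
        (∀ i, (H' i).Nonempty) ∧ (∀ i j, i ≠ j → H' i ≠ H' j) ∧
        SetFlatLE (H' 0) (H' 1) ∧ SetFlatLE (H' 1) (H' 2) ∧
        (H' 0).ncard = 1 ∧ (H' 2).ncard = 1}.ncard = k - 1 := by
  rw [setFlatLE_triples_eq_image, Set.ncard_image_of_injective _ fun m n h =>
    Set.singleton_injective (congrFun h 2), Set.ncard_compl, Set.ncard_singleton, Nat.card_fin]

/-- For the flat order `0 < 1, …, 0 < k-1` on `E_k`, every chain
`H_0 ≤ H_1 ≤ … ≤ H_{s+1}` of nonempty, pairwise distinct subsets with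
`|H_0| = |H_{s+1}| = 1` and `s ≥ 1` has `s = 1` and is of the form
`{0} < {0, m} < {m}` with `m ≠ 0`; in particular `|H_i| ≤ 2` for all `i`
(so the constant `d` equals `2`), and there are exactly `k - 1` such chains. -/
theorem flat_order_chains {k : ℕ} [NeZero k] (hk : 2 ≤ k)
    (s : ℕ) (hs : 1 ≤ s) (H : ℕ → Set (Fin k))
    (hne : ∀ i ≤ s + 1, (H i).Nonempty)
    (hdist : ∀ i ≤ s + 1, ∀ j ≤ s + 1, i ≠ j → H i ≠ H j)
    (hchain : ∀ i ≤ s, SetFlatLE (H i) (H (i + 1)))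
    (h0 : (H 0).ncard = 1) (hlast : (H (s + 1)).ncard = 1) :
    s = 1 ∧
    (∃ m : Fin k, m ≠ 0 ∧ H 0 = {0} ∧ H 1 = {0, m} ∧ H 2 = {m}) ∧
    (∀ i ≤ s + 1, (H i).ncard ≤ 2) ∧
    {H' : Fin 3 → Set (Fin k) |
        (∀ i, (H' i).Nonempty) ∧ (∀ i j, i ≠ j → H' i ≠ H' j) ∧
        SetFlatLE (H' 0) (H' 1) ∧ SetFlatLE (H' 1) (H' 2) ∧
        (H' 0).ncard = 1 ∧ (H' 2).ncard = 1}.ncard = k - 1 := by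
  obtain ⟨m, hm, e0, e1, e2⟩ := (hchain 0 (by omega)).eq_of_triple (hchain 1 hs)
    (hne 1 (by omega)) (hne 2 (by omega)) (hdist 0 (by omega) 1 (by omega) (by omega))
    (hdist 1 (by omega) 2 (by omega) (by omega)) h0
  have hs1 : s = 1 := by
    by_contra hs1
    have e3 : H 3 = {m} := (hchain 2 (by omega)).eq_singleton (hne 3 (by omega))
      (e2.symm.subset rfl) hm
    exact hdist 2 (by omega) 3 (by omega) (by omega) (e2.trans e3.symm)
  refine ⟨hs1, ⟨m, hm, e0, e1, e2⟩, fun i hi => ?_, ncard_setFlatLE_triples⟩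
  subst hs1
  interval_cases i
  · omega
  · rw [e1, Set.ncard_pair hm.symm]
  · exact hlast.le.trans one_le_two
end
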